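/- There exist a positive integer M and a norm N on ℝ × ℝ such that: N((1,0)) = N((0,1)) = 1; for all real x, y with x ≠ 0 and y ≠ 0, if N((x,y)) = 1 then |x| < 1 and |y| < 1; and for all real s, t with s > 0 and t > 0, N((−(1+t), (1+s)·t)) = (1+s)·(1+t) if and only if t = 2s + s² + (sin s)/M. -/

import Mathlib

/-- `N` is a norm on the real vector space `ℝ × ℝ`. -/
def IsNorm (N : ℝ × ℝ → ℝ) : Prop :=
  (∀ v, 0 ≤ N v) ∧ (∀ v, N v = 0 ↔ v = 0) ∧
    (∀ (a : ℝ) (v : ℝ × ℝ), N (a • v) = |a| * N v) ∧ ∀ v w, N (v + w) ≤ N v + N w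

open Real Set

/-- The unit sphere of the norm in the upper half plane is the graph of `1 - profile |x|`. -/
noncomputable def profile (x : ℝ) : ℝ := x ^ 2 / (1 + x ^ 2 * sin (x⁻¹ - 1) / 100)

lemma profile_denom_mem {x : ℝ} (hx : |x| ≤ 1) :
    1 + x ^ 2 * sin (x⁻¹ - 1) / 100 ∈ Icc (99 / 100 : ℝ) (101 / 100) := by
  have h1 := neg_one_le_sin (x⁻¹ - 1)
  have h2 := sin_le_one (x⁻¹ - 1)
  have h3 : x ^ 2 ≤ 1 := (sq_le_one_iff_abs_le_one x).2 hx
  have h4 := sq_nonneg x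
  constructor <;> nlinarith

lemma profile_nonneg {x : ℝ} (hx : |x| ≤ 1) : 0 ≤ profile x :=
  div_nonneg (sq_nonneg x) (by linarith [(profile_denom_mem hx).1])

lemma sq_div_two_le_profile {x : ℝ} (hx : |x| ≤ 1) : x ^ 2 / 2 ≤ profile x := by
  have h := profile_denom_mem hx
  exact div_le_div_of_nonneg_left (sq_nonneg x) (by linarith [h.1]) (by linarith [h.2])

lemma profile_le_two_mul_sq {x : ℝ} (hx : |x| ≤ 1) : profile x ≤ 2 * x ^ 2 := by
  have h := profile_denom_mem hx
  rw [profile, div_le_iff₀ (by linarith [h.1])]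
  nlinarith [h.1, sq_nonneg x]

@[simp] lemma profile_zero : profile 0 = 0 := by simp [profile]

@[simp] lemma profile_one : profile 1 = 1 := by simp [profile]

lemma three_mul_sub_two_le_profile {x : ℝ} (hx0 : 0 ≤ x) (hx1 : x ≤ 1) :
    3 * x - 2 ≤ profile x := by
  have habs : |x| ≤ 1 := by rwa [abs_of_nonneg hx0]
  rcases le_or_gt (3 * x - 2) 0 with h | h
  · exact h.trans (profile_nonneg habs)
  have hx : 0 < x := by linarith
  have hs : x ^ 2 * sin (x⁻¹ - 1) ≤ x * (1 - x) := by
    have h1 : sin (x⁻¹ - 1) ≤ x⁻¹ - 1 :=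
      sin_le (sub_nonneg.2 ((one_le_inv₀ hx).2 hx1))
    calc x ^ 2 * sin (x⁻¹ - 1) ≤ x ^ 2 * (x⁻¹ - 1) := by gcongr
      _ = x * (1 - x) := by field_simp
  rw [profile, le_div_iff₀ (by linarith [(profile_denom_mem habs).1])]
  have h2 : (3 * x - 2) * (x ^ 2 * sin (x⁻¹ - 1)) ≤ (3 * x - 2) * (x * (1 - x)) := by
    gcongr
  have h3 : (3 * x - 2) * x * (1 - x) ≤ 1 * (1 - x) :=
    mul_le_mul_of_nonneg_right (by nlinarith) (by linarith)
  nlinarith [sq_nonneg (1 - x)]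

lemma hasDerivAt_profile {x : ℝ} (hx0 : 0 < x) (hx1 : x < 1) :
    HasDerivAt profile ((2 * x + x ^ 2 * cos (x⁻¹ - 1) / 100) /
      (1 + x ^ 2 * sin (x⁻¹ - 1) / 100) ^ 2) x := by
  have hD : 1 + x ^ 2 * sin (x⁻¹ - 1) / 100 ≠ 0 := by
    have := (profile_denom_mem (abs_le.2 ⟨by linarith, hx1.le⟩)).1
    linarith
  have hi := (hasDerivAt_inv hx0.ne').sub_const 1
  have h2 := hasDerivAt_pow 2 x
  refine (h2.div (((h2.mul hi.sin).div_const 100).const_add 1) hD).congr_deriv ?_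
  simp only [Pi.mul_apply]
  congr 1
  push_cast
  field_simp
  ring

lemma hasDerivAt_deriv_profile {x : ℝ} (hx0 : 0 < x) (hx1 : x < 1) :
    HasDerivAt (fun x : ℝ ↦ (2 * x + x ^ 2 * cos (x⁻¹ - 1) / 100) /
      (1 + x ^ 2 * sin (x⁻¹ - 1) / 100) ^ 2)
      (((2 + (2 * x * cos (x⁻¹ - 1) + sin (x⁻¹ - 1)) / 100) *
        (1 + x ^ 2 * sin (x⁻¹ - 1) / 100) -
        2 * (2 * x + x ^ 2 * cos (x⁻¹ - 1) / 100) *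
          ((2 * x * sin (x⁻¹ - 1) - cos (x⁻¹ - 1)) / 100)) /
        (1 + x ^ 2 * sin (x⁻¹ - 1) / 100) ^ 3) x := by
  have hD : 1 + x ^ 2 * sin (x⁻¹ - 1) / 100 ≠ 0 := by
    have := (profile_denom_mem (abs_le.2 ⟨by linarith, hx1.le⟩)).1
    linarith
  have hi := (hasDerivAt_inv hx0.ne').sub_const 1
  have h2 := hasDerivAt_pow 2 x
  have hden : HasDerivAt (fun x : ℝ ↦ 1 + x ^ 2 * sin (x⁻¹ - 1) / 100)
      ((2 * x * sin (x⁻¹ - 1) - cos (x⁻¹ - 1)) / 100) x := by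
    refine (((h2.mul hi.sin).div_const 100).const_add 1).congr_deriv ?_
    push_cast
    field_simp
    ring
  have hnum : HasDerivAt (fun x : ℝ ↦ 2 * x + x ^ 2 * cos (x⁻¹ - 1) / 100)
      (2 + (2 * x * cos (x⁻¹ - 1) + sin (x⁻¹ - 1)) / 100) x := by
    refine (((hasDerivAt_id x).const_mul 2).add
      ((h2.mul hi.cos).div_const 100)).congr_deriv ?_
    push_cast
    field_simp
  refine (hnum.div (hden.pow 2) (pow_ne_zero 2 hD)).congr_deriv ?_
  simp only [Pi.pow_apply]
  generalize 1 + x ^ 2 * sin (x⁻¹ - 1) / 100 = D at hD ⊢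
  push_cast
  field_simp

lemma continuousOn_profile : ContinuousOn profile (Icc 0 1) := by
  intro x hx
  rcases hx.1.eq_or_lt with rfl | h0
  · rw [ContinuousWithinAt, profile_zero]
    have hup : Filter.Tendsto (fun x : ℝ ↦ 2 * x ^ 2) (nhdsWithin 0 (Icc 0 1)) (nhds 0) := by
      have : Continuous fun x : ℝ ↦ 2 * x ^ 2 := by fun_prop
      simpa using (this.tendsto 0).mono_left nhdsWithin_le_nhds
    refine tendsto_of_tendsto_of_tendsto_of_le_of_le' tendsto_const_nhds hup ?_ ?_
    all_goals
      filter_upwards [self_mem_nhdsWithin] with y hy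
      have hy' : |y| ≤ 1 := by rw [abs_of_nonneg hy.1]; exact hy.2
    · exact profile_nonneg hy'
    · exact profile_le_two_mul_sq hy'
  · have hD : 1 + x ^ 2 * sin (x⁻¹ - 1) / 100 ≠ 0 := by
      have := (profile_denom_mem (x := x) (by rw [abs_of_nonneg hx.1]; exact hx.2)).1
      linarith
    have : ContinuousAt profile x := by
      unfold profile
      fun_prop (disch := first | exact hD | exact h0.ne')
    exact this.continuousWithinAt

lemma convexOn_profile : ConvexOn ℝ (Icc 0 1) profile := by
  refine convexOn_of_hasDerivWithinAt2_nonneg (convex_Icc 0 1) continuousOn_profile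
    (fun x hx ↦ (hasDerivAt_profile (interior_Icc.subset hx).1
      (interior_Icc.subset hx).2).hasDerivWithinAt)
    (fun x hx ↦ (hasDerivAt_deriv_profile (interior_Icc.subset hx).1
      (interior_Icc.subset hx).2).hasDerivWithinAt) (fun x hx ↦ ?_)
  rw [interior_Icc] at hx
  obtain ⟨hx0, hx1⟩ := hx
  have habs : |x| ≤ 1 := abs_le.2 ⟨by linarith, hx1.le⟩
  have hD := (profile_denom_mem habs).1
  refine div_nonneg ?_ (pow_nonneg (by linarith) 3)
  have hs := abs_le.1 (abs_sin_le_one (x⁻¹ - 1))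
  have hc := abs_le.1 (abs_cos_le_one (x⁻¹ - 1))
  have hxc : |x * cos (x⁻¹ - 1)| ≤ 1 := by
    rw [abs_mul]
    exact mul_le_one₀ habs (abs_nonneg _) (abs_cos_le_one _)
  have hxs : |x * sin (x⁻¹ - 1)| ≤ 1 := by
    rw [abs_mul]
    exact mul_le_one₀ habs (abs_nonneg _) (abs_sin_le_one _)
  have hxxc : |x * (x * cos (x⁻¹ - 1))| ≤ 1 := by
    rw [abs_mul]
    exact mul_le_one₀ habs (abs_nonneg _) hxc
  rw [abs_le] at hxc hxs hxxc
  have h1 : (1 : ℝ) ≤ (2 + (2 * x * cos (x⁻¹ - 1) + sin (x⁻¹ - 1)) / 100) *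
      (1 + x ^ 2 * sin (x⁻¹ - 1) / 100) := by
    nlinarith
  have h2 : |(2 * x + x ^ 2 * cos (x⁻¹ - 1) / 100) *
      ((2 * x * sin (x⁻¹ - 1) - cos (x⁻¹ - 1)) / 100)| ≤ 3 * (3 / 100) := by
    rw [abs_mul]
    gcongr <;> rw [abs_le] <;> constructor <;> nlinarith
  linarith [(abs_le.1 h2).2]

lemma profile_mul_le {r x : ℝ} (hr0 : 0 ≤ r) (hr1 : r ≤ 1) (hx0 : 0 ≤ x) (hx1 : x ≤ 1) :
    profile (r * x) ≤ r * profile x := by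
  simpa using convexOn_profile.2 ⟨hx0, hx1⟩ ⟨le_rfl, zero_le_one⟩ hr0 (sub_nonneg.2 hr1)
    (by ring)

lemma profile_le_self {x : ℝ} (hx0 : 0 ≤ x) (hx1 : x ≤ 1) : profile x ≤ x := by
  simpa using profile_mul_le hx0 hx1 zero_le_one le_rfl

lemma monotoneOn_profile : MonotoneOn profile (Icc 0 1) := by
  intro x hx y hy hxy
  rcases hy.1.eq_or_lt with h | h
  · rw [le_antisymm (hxy.trans h.ge) (h ▸ hx.1)]
    exact profile_zero.trans_le (profile_nonneg (by rw [← h]; simp))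
  have h1 := profile_mul_le (div_nonneg hx.1 h.le) ((div_le_one h).2 hxy) hy.1 hy.2
  rw [div_mul_cancel₀ _ h.ne'] at h1
  exact h1.trans (mul_le_of_le_one_left
    (profile_nonneg (by rw [abs_of_pos h]; exact hy.2)) ((div_le_one h).2 hxy))

/-- The unit ball of the norm. -/
def profileBall : Set (ℝ × ℝ) := {v | |v.1| ≤ 1 ∧ profile |v.1| + |v.2| ≤ 1}

lemma convex_profileBall : Convex ℝ profileBall := by
  rintro ⟨x, y⟩ ⟨hx, hxy⟩ ⟨z, w⟩ ⟨hz, hzw⟩ a b ha hb hab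
  simp only [profileBall, mem_ofPred_eq, Prod.smul_mk, Prod.mk_add_mk, smul_eq_mul] at *
  have key (p q : ℝ) : |a * p + b * q| ≤ a * |p| + b * |q| := by
    simpa [abs_mul, abs_of_nonneg ha, abs_of_nonneg hb] using abs_add_le (a * p) (b * q)
  have hle : a * |x| + b * |z| ≤ 1 := by nlinarith
  refine ⟨(key x z).trans hle, ?_⟩
  have h1 := monotoneOn_profile ⟨abs_nonneg _, (key x z).trans hle⟩ ⟨by positivity, hle⟩ (key x z)
  have h2 := convexOn_profile.2 ⟨abs_nonneg x, hx⟩ ⟨abs_nonneg z, hz⟩ ha hb hab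
  simp only [smul_eq_mul] at h2
  nlinarith [key y w]

lemma mem_profileBall_of_abs_add_abs_le {v : ℝ × ℝ} (hv : |v.1| + |v.2| ≤ 1) :
    v ∈ profileBall := by
  have h : |v.1| ≤ 1 := by linarith [abs_nonneg v.2]
  exact ⟨h, by linarith [profile_le_self (abs_nonneg _) h]⟩

lemma profileBall_mem_nhds : profileBall ∈ nhds (0 : ℝ × ℝ) := by
  have h : Continuous fun v : ℝ × ℝ ↦ |v.1| + |v.2| := by fun_prop
  refine Filter.mem_of_superset ((isOpen_lt h (continuous_const (y := 1))).mem_nhds ?_)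
    fun v hv ↦ mem_profileBall_of_abs_add_abs_le (le_of_lt hv)
  simp

lemma absorbent_profileBall : Absorbent ℝ profileBall :=
  absorbent_nhds_zero profileBall_mem_nhds

lemma gauge_profileBall_smul (a : ℝ) (v : ℝ × ℝ) :
    gauge profileBall (a • v) = |a| * gauge profileBall v := by
  have hsymm : ∀ w ∈ profileBall, -w ∈ profileBall := fun w hw ↦ by
    simpa [profileBall] using hw
  rw [← smul_eq_mul, ← gauge_smul_of_nonneg (abs_nonneg a)]
  rcases abs_choice a with h | h
  · rw [h]
  · rw [h, neg_smul, gauge_neg hsymm]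

/-- A weighted sum of the absolute values of the coordinates that is bounded on the unit ball
is bounded by a multiple of the norm. -/
lemma le_mul_gauge_profileBall {a b c : ℝ} (hc : 0 < c)
    (h : ∀ v ∈ profileBall, a * |v.1| + b * |v.2| ≤ c) (v : ℝ × ℝ) :
    a * |v.1| + b * |v.2| ≤ c * gauge profileBall v := by
  rw [mul_comm c, ← div_le_iff₀ hc]
  refine le_of_forall_gt fun d hd ↦ ?_
  obtain ⟨r, hr0, hrd, w, hw, rfl⟩ := exists_lt_of_gauge_lt absorbent_profileBall hd
  refine lt_of_le_of_lt ?_ hrd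
  rw [div_le_iff₀ hc]
  simp only [Prod.smul_fst, Prod.smul_snd, smul_eq_mul, abs_mul, abs_of_pos hr0]
  nlinarith [h w hw]

lemma abs_add_abs_div_three_le_gauge (v : ℝ × ℝ) :
    |v.1| + |v.2| / 3 ≤ gauge profileBall v := by
  have := le_mul_gauge_profileBall (a := 1) (b := 1 / 3) one_pos (fun w hw ↦ by
    linarith [hw.2, three_mul_sub_two_le_profile (abs_nonneg w.1) hw.1]) v
  linarith

lemma abs_snd_le_of_gauge_eq_one {v : ℝ × ℝ} (hv : gauge profileBall v = 1) :
    |v.2| ≤ 1 - v.1 ^ 2 / 2 := by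
  have := le_mul_gauge_profileBall (a := |v.1|) (b := 1) (c := 1 + v.1 ^ 2 / 2) (by positivity)
    (fun w hw ↦ by
      have := sq_div_two_le_profile (x := |w.1|) (by simpa using hw.1)
      nlinarith [hw.2, sq_nonneg (|v.1| - |w.1|), sq_abs v.1]) v
  nlinarith [sq_abs v.1]

lemma gauge_profileBall_eq_one {v : ℝ × ℝ} (h1 : |v.1| ≤ 1) (h2 : profile |v.1| + |v.2| = 1) :
    gauge profileBall v = 1 := by
  refine le_antisymm (gauge_le_one_of_mem ⟨h1, h2.le⟩) (not_lt.1 fun h ↦ ?_)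
  obtain ⟨r, hr0, hr1, w, hw, rfl⟩ := exists_lt_of_gauge_lt absorbent_profileBall h
  simp only [Prod.smul_fst, Prod.smul_snd, smul_eq_mul, abs_mul, abs_of_pos hr0] at h2
  have := profile_mul_le hr0.le hr1.le (abs_nonneg w.1) hw.1
  nlinarith [hw.2]

lemma isNorm_gauge_profileBall : IsNorm (gauge profileBall) := by
  refine ⟨gauge_nonneg, fun v ↦ ⟨fun h ↦ ?_, fun h ↦ h ▸ gauge_zero⟩, gauge_profileBall_smul,
    gauge_add_le convex_profileBall absorbent_profileBall⟩
  have h3 := abs_add_abs_div_three_le_gauge v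
  have h1 := abs_nonneg v.1
  have h2 := abs_nonneg v.2
  exact Prod.ext (abs_eq_zero.1 (by linarith)) (abs_eq_zero.1 (by linarith))

/-- Along a vertical ray on which a norm starts below `1`, it takes the value `1` at most once. -/
lemma IsNorm.eq_of_eq_one {N : ℝ × ℝ → ℝ} (hN : IsNorm N) {x y z : ℝ} (hx : N (x, 0) < 1)
    (hy : 0 < y) (hz : 0 < z) (hNy : N (x, y) = 1) (hNz : N (x, z) = 1) : y = z := by
  have key : ∀ {y z : ℝ}, 0 < y → N (x, y) = 1 → N (x, z) = 1 → ¬ y < z := by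
    intro y z hy hNy hNz hyz
    have hz := hy.trans hyz
    have hr : 0 < 1 - y / z := sub_pos.2 ((div_lt_one hz).2 hyz)
    have h := hN.2.2.2 ((1 - y / z) • (x, 0)) ((y / z) • (x, z))
    rw [hN.2.2.1, hN.2.2.1, abs_of_pos hr, abs_of_pos (div_pos hy hz), hNz] at h
    have he : (1 - y / z) • (x, (0 : ℝ)) + (y / z) • (x, z) = (x, y) := by
      ext
      · simp; ring
      · simp [hz.ne']
    rw [he, hNy] at h
    nlinarith
  exact le_antisymm (not_lt.1 (key hz hNz hNy)) (not_lt.1 (key hy hNy hNz))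

lemma profile_inv_one_add {s : ℝ} (hs : 0 < s) :
    profile (1 + s)⁻¹ = ((1 + s) ^ 2 + sin s / 100)⁻¹ := by
  have h : (1 + s) ^ 2 + sin s / 100 ≠ 0 := by nlinarith [neg_one_le_sin s]
  rw [profile, inv_inv, add_sub_cancel_left]
  have h1 : 1 + (1 + s)⁻¹ ^ 2 * sin s / 100 =
      (1 + s)⁻¹ ^ 2 * ((1 + s) ^ 2 + sin s / 100) := by
    field_simp
  rw [h1, div_mul_cancel_left₀ (by positivity)]

lemma gauge_profileBall_neg_eq_one_iff {x y : ℝ} (hx0 : 0 < x) (hx1 : x < 1) (hy : 0 < y) :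
    gauge profileBall (-x, y) = 1 ↔ y = 1 - profile x := by
  have hlt : 0 < 1 - profile x := by linarith [profile_le_self hx0.le hx1.le]
  have hg : gauge profileBall (-x, 1 - profile x) = 1 :=
    gauge_profileBall_eq_one (by simpa [abs_of_pos hx0] using hx1.le)
      (by simp [abs_of_pos hx0, abs_of_pos hlt])
  refine ⟨fun h ↦ isNorm_gauge_profileBall.eq_of_eq_one ?_ hy hlt h hg, fun h ↦ h ▸ hg⟩
  have he : ((-x, 0) : ℝ × ℝ) = (-x) • (1, 0) := by simp
  rw [he, gauge_profileBall_smul, gauge_profileBall_eq_one (by simp) (by simp), abs_neg,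
    abs_of_pos hx0, mul_one]
  exact hx1

theorem stmt_18 :
    ∃ (M : ℕ) (N : ℝ × ℝ → ℝ), 0 < M ∧ IsNorm N ∧
      N (1, 0) = 1 ∧ N (0, 1) = 1 ∧
      (∀ x y : ℝ, x ≠ 0 → y ≠ 0 → N (x, y) = 1 → |x| < 1 ∧ |y| < 1) ∧
      ∀ s t : ℝ, 0 < s → 0 < t →
        (N (-(1 + t), (1 + s) * t) = (1 + s) * (1 + t) ↔
          t = 2 * s + s ^ 2 + Real.sin s / M) := by
  refine ⟨100, gauge profileBall, by norm_num, isNorm_gauge_profileBall,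
    gauge_profileBall_eq_one (by simp) (by simp), gauge_profileBall_eq_one (by simp) (by simp),
    fun x y hx hy h ↦ ⟨?_, ?_⟩, fun s t hs ht ↦ ?_⟩
  · have h1 := abs_add_abs_div_three_le_gauge (x, y)
    have h2 := abs_pos.2 hy
    simp only [h] at h1
    linarith
  · have h1 := abs_snd_le_of_gauge_eq_one h
    have h2 := pow_pos (abs_pos.2 hx) 2
    simp only [sq_abs] at h1 h2
    linarith
  have he : ((-(1 + t), (1 + s) * t) : ℝ × ℝ) =
      ((1 + s) * (1 + t)) • (-(1 + s)⁻¹, t / (1 + t)) := by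
    ext <;> simp only [Prod.smul_mk, smul_eq_mul] <;> field_simp
  have ht' : t / (1 + t) = 1 - (1 + t)⁻¹ := by field_simp; ring
  rw [he, gauge_profileBall_smul, abs_of_pos (by positivity), mul_eq_left₀ (by positivity),
    gauge_profileBall_neg_eq_one_iff (by positivity) (inv_lt_one_of_one_lt₀ (by linarith))
      (by positivity), profile_inv_one_add hs, ht', sub_right_inj, inv_inj]
  push_cast
  constructor <;> intro h <;> linarith
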